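/- arXiv:2308.13391 — 3 statements merged into one kernel-verified Lean document; each statement's English description precedes it below -/
import Mathlib

section
/- Let G be a group whose center Z(G) has finite index in G, and let N be a normal subgroup of G. Then the set of element centralizers of the quotient group G/N has the same cardinality as the set of element centralizers of the quotient group G/([G,G] ∩ N). -/
/-- `Cent G` is the set of element centralizers of `G`. -/
def Cent (G : Type*) [Group G] : Set (Subgroup G) :=
  Set.range fun x : G => Subgroup.centralizer {x}

open scoped commutatorElement in
/-- An element of `G` maps into the centralizer of the image of `x` in `G ⧸ N` exactly when its
commutator with `x` lies in `N`. -/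
theorem mem_comap_mk'_centralizer_singleton {G : Type*} [Group G] (N : Subgroup G) [N.Normal]
    (x y : G) :
    y ∈ (Subgroup.centralizer {(x : G ⧸ N)}).comap (QuotientGroup.mk' N) ↔ ⁅x, y⁆ ∈ N := by
  rw [Subgroup.mem_comap, Subgroup.mem_centralizer_singleton_iff, ← QuotientGroup.eq_one_iff,
    ← QuotientGroup.mk'_apply N ⁅x, y⁆, map_commutatorElement,
    commutatorElement_eq_one_iff_mul_comm]
  exact eq_comm

/-- The centralizers of elements of `G ⧸ N`, pulled back to `G`. -/
theorem image_comap_mk'_cent {G : Type*} [Group G] (N : Subgroup G) [N.Normal] :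
    Subgroup.comap (QuotientGroup.mk' N) '' Cent (G ⧸ N) =
      Set.range fun x : G =>
        (Subgroup.centralizer {(x : G ⧸ N)}).comap (QuotientGroup.mk' N) := by
  rw [Cent, ← Set.range_comp, ← (QuotientGroup.mk_surjective (s := N)).range_comp]
  rfl

/-- Let `G` be a group whose center has finite index and `N` a normal subgroup of `G`.
Then `|Cent(G/N)| = |Cent(G/([G,G] ⊓ N))|`. -/
theorem cent_quotient_card_eq_cent_quotient_commutator_inf
    (G : Type*) [Group G] [(Subgroup.center G).FiniteIndex]
    (N : Subgroup G) [N.Normal] :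
    Nat.card (Cent (G ⧸ N)) = Nat.card (Cent (G ⧸ (commutator G ⊓ N))) := by
  rw [← Nat.card_image_of_injective
      (Subgroup.comap_injective (QuotientGroup.mk'_surjective N)) (Cent (G ⧸ N)),
    ← Nat.card_image_of_injective
      (Subgroup.comap_injective (QuotientGroup.mk'_surjective (commutator G ⊓ N)))
      (Cent (G ⧸ (commutator G ⊓ N))),
    image_comap_mk'_cent, image_comap_mk'_cent]
  congr! 4 with x
  ext y
  rw [mem_comap_mk'_centralizer_singleton, mem_comap_mk'_centralizer_singleton, Subgroup.mem_inf]
  exact (and_iff_right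
    (Subgroup.commutator_mem_commutator (Subgroup.mem_top x) (Subgroup.mem_top y))).symm
end

section
/- Let G be a group whose center Z(G) has finite index in G, and let N be a normal subgroup of G with [G,G] ∩ N = {1}. Then |Cent(G)| = |Cent(G/N)|. -/
open scoped commutatorElement in
/-- If `N` meets the commutator subgroup trivially, then elements commute modulo `N` only when
they commute. -/
theorem commute_mk_iff_of_commutator_inf_eq_bot {G : Type*} [Group G] {N : Subgroup G} [N.Normal]
    (h : commutator G ⊓ N = ⊥) (x y : G) :
    Commute (x : G ⧸ N) (y : G ⧸ N) ↔ Commute x y := by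
  refine ⟨fun hxy => ?_, fun hxy => hxy.map (QuotientGroup.mk' N)⟩
  have hN : ⁅x, y⁆ ∈ N := by
    rw [← QuotientGroup.eq_one_iff]
    exact (map_commutatorElement (QuotientGroup.mk' N) x y).trans
      (commutatorElement_eq_one_iff_commute.mpr hxy)
  have hG : ⁅x, y⁆ ∈ commutator G :=
    Subgroup.commutator_mem_commutator (Subgroup.mem_top x) (Subgroup.mem_top y)
  exact commutatorElement_eq_one_iff_commute.mp <| Subgroup.mem_bot.mp (h ▸ ⟨hG, hN⟩)

/-- If `N` meets the commutator subgroup trivially, then the centralizer of `x` is the preimage of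
the centralizer of its class modulo `N`. -/
theorem comap_mk'_centralizer_singleton {G : Type*} [Group G] {N : Subgroup G} [N.Normal]
    (h : commutator G ⊓ N = ⊥) (x : G) :
    (Subgroup.centralizer {(x : G ⧸ N)}).comap (QuotientGroup.mk' N) =
      Subgroup.centralizer {x} := by
  ext y
  rw [Subgroup.mem_comap, Subgroup.mem_centralizer_singleton_iff,
    Subgroup.mem_centralizer_singleton_iff]
  exact commute_mk_iff_of_commutator_inf_eq_bot h _ _

/-- Let `G` be a group whose center has finite index and `N` a normal subgroup of `G`
with `[G,G] ⊓ N = ⊥`. Then `|Cent(G)| = |Cent(G/N)|`. -/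
theorem cent_card_eq_cent_quotient_of_commutator_inf_eq_bot
    (G : Type*) [Group G] [(Subgroup.center G).FiniteIndex]
    (N : Subgroup G) [N.Normal] (h : commutator G ⊓ N = ⊥) :
    Nat.card (Cent G) = Nat.card (Cent (G ⧸ N)) := by
  have hCent : Cent G = Subgroup.comap (QuotientGroup.mk' N) '' Cent (G ⧸ N) := by
    rw [Cent, Cent, ← Set.range_comp, ← (QuotientGroup.mk'_surjective N).range_comp]
    exact congrArg Set.range (funext fun x => (comap_mk'_centralizer_singleton h x).symm)
  rw [hCent]
  exact Nat.card_image_of_injective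
    (Subgroup.comap_injective (QuotientGroup.mk'_surjective N)) _
end

section
/- Let G be a group whose center Z(G) has finite index in G. If the commutator subgroup [G,G] has order 2, then |Cent(G)| equals the index [G : Z(G)]. -/
open scoped commutatorElement

theorem commute_inv_mul_of_conj_eq {G : Type*} [Group G] {x y g : G}
    (h : x * g * x⁻¹ = y * g * y⁻¹) : Commute (x⁻¹ * y) g := by
  have h' : x * g * x⁻¹ * y = y * g := by rw [h]; group
  calc x⁻¹ * y * g = x⁻¹ * (y * g) := mul_assoc _ _ _
    _ = g * (x⁻¹ * y) := by rw [← h']; group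

theorem commutatorElement_eq_of_card_commutator_eq_two {G : Type*} [Group G]
    (h : Nat.card (commutator G) = 2) {x y g : G} (hx : ⁅x, g⁆ ≠ 1) (hy : ⁅y, g⁆ ≠ 1) :
    ⁅x, g⁆ = ⁅y, g⁆ := by
  have mem (a : G) : ⁅a, g⁆ ∈ commutator G :=
    Subgroup.commutator_mem_commutator (Subgroup.mem_top a) (Subgroup.mem_top g)
  have key := ((Nat.card_eq_two_iff' (1 : commutator G)).1 h).unique
    (y₁ := ⟨_, mem x⟩) (y₂ := ⟨_, mem y⟩)
    (fun e => hx (congrArg Subtype.val e)) (fun e => hy (congrArg Subtype.val e))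
  exact congrArg Subtype.val key

theorem centralizer_singleton_eq_iff_of_card_commutator_eq_two {G : Type*} [Group G]
    (h : Nat.card (commutator G) = 2) (x y : G) :
    Subgroup.centralizer {x} = Subgroup.centralizer {y} ↔ x⁻¹ * y ∈ Subgroup.center G := by
  constructor
  · intro e
    refine Subgroup.mem_center_iff.2 fun g => ?_
    have hg : x * g = g * x ↔ y * g = g * y := by
      simpa only [Subgroup.mem_centralizer_singleton_iff, eq_comm] using SetLike.ext_iff.1 e g
    refine (commute_inv_mul_of_conj_eq ?_).eq.symm
    by_cases hx : x * g = g * x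
    · rw [hx, hg.1 hx, mul_inv_cancel_right, mul_inv_cancel_right]
    · exact mul_right_cancel (commutatorElement_eq_of_card_commutator_eq_two h
        (mt commutatorElement_eq_one_iff_mul_comm.1 hx)
        (mt commutatorElement_eq_one_iff_mul_comm.1 (mt hg.2 hx)))
  · intro hc
    ext g
    have hcg : Commute (x⁻¹ * y) g := (Subgroup.mem_center_iff.1 hc g).symm
    simp only [Subgroup.mem_centralizer_singleton_iff]
    have hyg (hx : Commute g x) : Commute g y := by simpa using hx.mul_right hcg.symm
    have hxg (hy : Commute g y) : Commute g x := by simpa using hy.mul_right hcg.symm.inv_right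
    exact ⟨fun hx => hyg hx, fun hy => hxg hy⟩

/-- If `Z(G)` has finite index in `G` and `|[G,G]| = 2`, then `|Cent(G)| = [G : Z(G)]`. -/
theorem cent_card_eq_index_center_of_card_commutator_eq_two
    (G : Type*) [Group G] [(Subgroup.center G).FiniteIndex]
    (h : Nat.card (commutator G) = 2) :
    Nat.card (Cent G) = (Subgroup.center G).index := by
  refine Nat.card_congr ((Setoid.quotientKerEquivRange _).symm.trans
    (Quotient.congrRight fun x y => ?_))
  rw [QuotientGroup.leftRel_apply]
  exact centralizer_singleton_eq_iff_of_card_commutator_eq_two h x y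
end
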